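/- arXiv:2303.08000 — 11 statements merged into one kernel-verified Lean document; each statement's English description precedes it below -/
import Mathlib

section
/- A k-linear functional ξ : k(Γ;F) → k is Σ-preserving if and only if there exists g ∈ k(Γ;F^⊥) such that ξ(f) = ⟨f,g⟩ for all f ∈ k(Γ;F); moreover every functional of the form ⟨-,g⟩ with g ∈ k(Γ;F^⊥) is Σ-preserving, and such g is unique (its value at γ is ξ applied to the indicator function of γ). -/
open Function

structure Borno (Γ : Type) where
  sets : Set (Set Γ)
  finite_mem : ∀ s : Set Γ, s.Finite → s ∈ sets
  subset_mem : ∀ s t : Set Γ, s ⊆ t → t ∈ sets → s ∈ sets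
  union_mem : ∀ s t : Set Γ, s ∈ sets → t ∈ sets → s ∪ t ∈ sets

def Borno.orth {Γ : Type} (F : Borno Γ) : Borno Γ where
  sets := {S | ∀ A ∈ F.sets, (S ∩ A).Finite}
  finite_mem := fun _ hs A _ => hs.inter_of_left A
  subset_mem := fun s t hst ht A hA =>
    (ht A hA).subset (Set.inter_subset_inter hst (subset_refl A))
  union_mem := fun s t hs ht A hA => by
    rw [Set.union_inter_distrib_right]
    exact (hs A hA).union (ht A hA)

def bspace (k : Type) [Field k] {Γ : Type} (F : Borno Γ) : Submodule k (Γ → k) where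
  carrier := {f | Function.support f ∈ F.sets}
  add_mem' := fun {f} {g} hf hg =>
    F.subset_mem _ _ (Function.support_add f g) (F.union_mem _ _ hf hg)
  zero_mem' := F.finite_mem _ (by simp)
  smul_mem' := fun c f hf =>
    F.subset_mem _ _ (Function.support_const_smul_subset c f) hf

def SummableFam {k : Type} [Field k] {Γ : Type} (F : Borno Γ) {ι : Type} (f : ι → Γ → k) : Prop :=
  (⋃ i, Function.support (f i)) ∈ F.sets ∧ ∀ γ : Γ, {i | f i γ ≠ 0}.Finite

noncomputable def famSum {k Γ ι : Type} [Field k] (f : ι → Γ → k) : Γ → k :=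
  fun γ => ∑ᶠ i, f i γ

theorem famSum_mem {k : Type} [Field k] {Γ ι : Type} (F : Borno Γ) (f : ι → Γ → k)
    (hf : SummableFam F f) : famSum f ∈ bspace k F := by
  refine F.subset_mem _ _ ?_ hf.1
  intro γ hγ
  by_contra hns
  simp only [Set.mem_iUnion, Function.mem_support] at hns
  push_neg at hns
  exact hγ (by simpa [famSum] using finsum_eq_zero_of_forall_eq_zero hns)

noncomputable def sumElem {k : Type} [Field k] {Γ ι : Type} (F : Borno Γ)
    (f : ι → bspace k F) (hf : SummableFam F (fun i => (f i : Γ → k))) : bspace k F :=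
  ⟨famSum (fun i => (f i : Γ → k)), famSum_mem F _ hf⟩

def SigmaPreserving {k : Type} [Field k] {Γ Δ : Type} {F : Borno Γ} {G : Borno Δ}
    (T : bspace k F →ₗ[k] bspace k G) : Prop :=
  ∀ (ι : Type) (f : ι → bspace k F) (hf : SummableFam F (fun i => (f i : Γ → k))),
    ∃ hg : SummableFam G (fun i => (T (f i) : Δ → k)),
      T (sumElem F f hf) = sumElem G (fun i => T (f i)) hg

noncomputable def pairing {k Γ : Type} [Field k] (f g : Γ → k) : k := ∑ᶠ γ, f γ * g γ

noncomputable def indic {k : Type} [Field k] {Γ : Type} (F : Borno Γ) (γ : Γ) : bspace k F :=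
  ⟨Set.indicator {γ} (fun _ => (1 : k)),
    F.subset_mem _ _ Set.support_indicator_subset
      (F.finite_mem _ (Set.finite_singleton γ))⟩

/-- A linear functional on `k(Γ;F)` is Σ-preserving: it sends summable families to families
with finitely many nonzero values, and commutes with sums. -/
def SigmaPreservingFunc {k : Type} [Field k] {Γ : Type} {F : Borno Γ}
    (ξ : bspace k F →ₗ[k] k) : Prop :=
  ∀ (ι : Type) (f : ι → bspace k F) (hf : SummableFam F (fun i => (f i : Γ → k))),
    {i | ξ (f i) ≠ 0}.Finite ∧ ξ (sumElem F f hf) = ∑ᶠ i, ξ (f i)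

/-- The coordinate expansion `f = ∑ f γ • indic γ` is a summable family. -/
theorem summableFam_smul_indic {k : Type} [Field k] {Γ : Type} (F : Borno Γ) (f : bspace k F) :
    SummableFam F (fun γ => ((f.1 γ • indic F γ : bspace k F) : Γ → k)) := by
  refine ⟨F.subset_mem _ _ ?_ f.2, fun γ => (Set.finite_singleton γ).subset ?_⟩
  · refine Set.iUnion_subset fun γ δ hδ => ?_
    by_cases h : δ = γ
    · subst h
      exact fun h0 => hδ (by simp [h0])
    · exact absurd (by simp [indic, h]) hδ
  · intro δ hδ
    by_contra h
    exact hδ (by simp [indic, show γ ≠ δ from fun h' => h h'.symm])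

theorem sumElem_smul_indic {k : Type} [Field k] {Γ : Type} (F : Borno Γ) (f : bspace k F) :
    sumElem F (fun γ => f.1 γ • indic F γ) (summableFam_smul_indic F f) = f := by
  ext γ
  refine (finsum_eq_single _ γ fun δ hδ => ?_).trans ?_
  · simp [indic, hδ.symm]
  · simp [indic]

theorem summableFam_indic {k : Type} [Field k] {Γ : Type} (F : Borno Γ) {A : Set Γ}
    (hA : A ∈ F.sets) : SummableFam F (fun γ : A => ((indic F (γ : Γ) : bspace k F) : Γ → k)) := by
  refine ⟨F.subset_mem _ _ (Set.iUnion_subset fun γ => ?_) hA, fun γ => ?_⟩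
  · exact Set.support_indicator_subset.trans (Set.singleton_subset_iff.2 γ.2)
  · refine Set.Subsingleton.finite fun a ha b hb => Subtype.ext ?_
    have key : ∀ c : A, ((indic F (c : Γ) : bspace k F) : Γ → k) γ ≠ 0 → γ = c := fun c hc => by
      by_contra h
      exact hc (by simp [indic, h])
    exact (key a ha).symm.trans (key b hb)

theorem SigmaPreservingFunc.mem_orth {k : Type} [Field k] {Γ : Type} {F : Borno Γ}
    {ξ : bspace k F →ₗ[k] k} (hξ : SigmaPreservingFunc ξ) :
    (fun γ => ξ (indic F γ)) ∈ bspace k F.orth := by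
  intro A hA
  refine ((hξ A _ (summableFam_indic F hA)).1.image Subtype.val).subset ?_
  rintro γ ⟨hγ, hγA⟩
  exact ⟨⟨γ, hγA⟩, hγ, rfl⟩

theorem SigmaPreservingFunc.eq_pairing {k : Type} [Field k] {Γ : Type} {F : Borno Γ}
    {ξ : bspace k F →ₗ[k] k} (hξ : SigmaPreservingFunc ξ) (f : bspace k F) :
    ξ f = pairing (f : Γ → k) (fun γ => ξ (indic F γ)) := by
  have h := (hξ Γ _ (summableFam_smul_indic F f)).2
  rw [sumElem_smul_indic] at h
  simpa [pairing] using h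

theorem pairing_indic {k : Type} [Field k] {Γ : Type} (F : Borno Γ) (g : Γ → k) (γ : Γ) :
    pairing ((indic F γ : bspace k F) : Γ → k) g = g γ := by
  refine (finsum_eq_single _ γ fun δ hδ => ?_).trans ?_
  · simp [indic, hδ]
  · simp [indic]

theorem sigmaPreservingFunc_of_eq_pairing {k : Type} [Field k] {Γ : Type} {F : Borno Γ}
    {ξ : bspace k F →ₗ[k] k} {g : Γ → k} (hg : g ∈ bspace k F.orth)
    (h : ∀ f : bspace k F, ξ f = pairing (f : Γ → k) g) : SigmaPreservingFunc ξ := by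
  classical
  intro ι f hf
  have hS : (support g ∩ ⋃ i, support (f i : Γ → k)).Finite := hg _ hf.1
  let S : Finset Γ := hS.toFinset
  have hT : (⋃ γ ∈ S, {i | (f i : Γ → k) γ ≠ 0}).Finite :=
    S.finite_toSet.biUnion fun γ _ => hf.2 γ
  let T : Finset ι := hT.toFinset
  have eq_sum (i : ι) : ξ (f i) = ∑ γ ∈ S, (f i : Γ → k) γ * g γ := by
    rw [h]
    refine finsum_eq_sum_of_support_subset _ fun γ hγ => ?_
    exact hS.mem_toFinset.2
      ⟨right_ne_zero_of_mul hγ, Set.mem_iUnion.2 ⟨i, left_ne_zero_of_mul hγ⟩⟩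
  have hsupp : {i | ξ (f i) ≠ 0} ⊆ T := by
    intro i hi
    rw [Set.mem_ofPred_eq, eq_sum] at hi
    obtain ⟨γ, hγ, hne⟩ := Finset.exists_ne_zero_of_sum_ne_zero hi
    exact hT.mem_toFinset.2 (Set.mem_biUnion hγ (left_ne_zero_of_mul hne))
  refine ⟨T.finite_toSet.subset hsupp, ?_⟩
  have sum_apply (γ : Γ) (hγ : γ ∈ S) :
      (sumElem F f hf : Γ → k) γ = ∑ i ∈ T, (f i : Γ → k) γ :=
    finsum_eq_sum_of_support_subset _ fun i hi => hT.mem_toFinset.2 (Set.mem_biUnion hγ hi)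
  calc
    ξ (sumElem F f hf) = ∑ γ ∈ S, (sumElem F f hf : Γ → k) γ * g γ := by
      rw [h]
      refine finsum_eq_sum_of_support_subset _ fun γ hγ => ?_
      refine hS.mem_toFinset.2 ⟨right_ne_zero_of_mul hγ, ?_⟩
      obtain ⟨i, hi⟩ := not_forall.1
        (mt finsum_eq_zero_of_forall_eq_zero (left_ne_zero_of_mul hγ))
      exact Set.mem_iUnion.2 ⟨i, hi⟩
    _ = ∑ γ ∈ S, ∑ i ∈ T, (f i : Γ → k) γ * g γ :=
      Finset.sum_congr rfl fun γ hγ => by rw [sum_apply γ hγ, Finset.sum_mul]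
    _ = ∑ i ∈ T, ξ (f i) := by
      rw [Finset.sum_comm]
      exact Finset.sum_congr rfl fun i _ => (eq_sum i).symm
    _ = ∑ᶠ i, ξ (f i) := (finsum_eq_sum_of_support_subset _ hsupp).symm

/-- a linear functional `ξ : k(Γ;F) → k` is Σ-preserving iff it is of the form
`⟨-, g⟩` for some `g ∈ k(Γ;F^⊥)`; every such functional is Σ-preserving, and `g` is unique,
its value at `γ` being `ξ` applied to the indicator function of `γ`. -/
theorem stmt0 {k : Type} [Field k] {Γ : Type} (F : Borno Γ) (ξ : bspace k F →ₗ[k] k) :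
    (SigmaPreservingFunc ξ ↔
      ∃ g ∈ bspace k F.orth, ∀ f : bspace k F, ξ f = pairing (f : Γ → k) g) ∧
    (∀ g ∈ bspace k F.orth, (∀ f : bspace k F, ξ f = pairing (f : Γ → k) g) →
      ∀ γ : Γ, g γ = ξ (indic F γ)) := by
  refine ⟨⟨fun hξ => ⟨_, hξ.mem_orth, hξ.eq_pairing⟩, ?_⟩, fun g _ h γ => ?_⟩
  · rintro ⟨g, hg, h⟩
    exact sigmaPreservingFunc_of_eq_pairing hg h
  · rw [h, pairing_indic]
end

section
/- If (f_i)_{i∈I} is a summable family in k(Γ;F), then for every g ∈ k(Γ;F^⊥) the set {i ∈ I : ⟨f_i,g⟩ ≠ 0} is finite and ⟨Σ_{i∈I} f_i, g⟩ = Σ_{i∈I} ⟨f_i,g⟩ (a finite sum). -/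
open Function

/-- A pairing may be computed over any finite set containing the common support. -/
theorem pairing_eq_sum {k Γ : Type} [Field k] {f g : Γ → k} {s : Finset Γ}
    (h : support f ∩ support g ⊆ s) : pairing f g = ∑ γ ∈ s, f γ * g γ :=
  finsum_eq_sum_of_support_subset _ (by rwa [support_mul])

/-- if `(f_i)` is summable in `k(Γ;F)` and `g ∈ k(Γ;F^⊥)`, then only finitely
many of the pairings `⟨f_i, g⟩` are nonzero, and `⟨Σ_i f_i, g⟩ = Σ_i ⟨f_i, g⟩`. -/
theorem stmt1 {k : Type} [Field k] {Γ ι : Type} (F : Borno Γ)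
    (f : ι → Γ → k) (hf : SummableFam F f)
    (g : Γ → k) (hg : g ∈ bspace k F.orth) :
    {i | pairing (f i) g ≠ 0}.Finite ∧
      pairing (famSum f) g = ∑ᶠ i, pairing (f i) g := by
  classical
  have hfin : (support g ∩ ⋃ i, support (f i)).Finite := hg _ hf.1
  set s := hfin.toFinset with hs
  set t := s.biUnion fun γ => (hf.2 γ).toFinset
  have hpair (i) : pairing (f i) g = ∑ γ ∈ s, f i γ * g γ := by
    refine pairing_eq_sum fun γ hγ => ?_
    rw [hs, hfin.coe_toFinset]
    exact ⟨hγ.2, Set.mem_iUnion_of_mem i hγ.1⟩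
  have hsum : pairing (famSum f) g = ∑ γ ∈ s, famSum f γ * g γ := by
    refine pairing_eq_sum fun γ hγ => ?_
    rw [hs, hfin.coe_toFinset]
    obtain ⟨i, hi⟩ := not_forall.1 (mt finsum_eq_zero_of_forall_eq_zero hγ.1)
    exact ⟨hγ.2, Set.mem_iUnion_of_mem i hi⟩
  have hmem {γ i} (hγ : γ ∈ s) (hi : f i γ ≠ 0) : i ∈ t :=
    Finset.mem_biUnion.2 ⟨γ, hγ, (hf.2 γ).mem_toFinset.2 hi⟩
  have hsub : (support fun i => pairing (f i) g) ⊆ t := by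
    intro i hi
    rw [mem_support, hpair] at hi
    obtain ⟨γ, hγ, hne⟩ := Finset.exists_ne_zero_of_sum_ne_zero hi
    exact hmem hγ (left_ne_zero_of_mul hne)
  refine ⟨t.finite_toSet.subset hsub, ?_⟩
  rw [finsum_eq_sum_of_support_subset _ hsub, hsum, Finset.sum_congr rfl fun i _ => hpair i,
    Finset.sum_comm]
  refine Finset.sum_congr rfl fun γ hγ => ?_
  rw [famSum, finsum_eq_sum_of_support_subset _ fun i hi => hmem hγ hi, Finset.sum_mul]
end

section
/- Let (η_i)_{i∈I} be a family in k(Γ;F^⊥) such that for every f ∈ k(Γ;F) the set {i ∈ I : ⟨f,η_i⟩ ≠ 0} is finite. Then (η_i)_{i∈I} is summable in k(Γ;F^⊥), i.e., ⋃_{i∈I} supp η_i ∈ F^⊥ and for every γ ∈ Γ only finitely many i satisfy η_i(γ) ≠ 0. -/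
open Function

/-- If a family is point-finite on `Γ` and each member has finite support on `A`, but the supports
jointly cover infinitely many points of `A`, then there is a sequence of points of `A` in the joint
support no two of which lie in a common support. -/
theorem exists_seq_separated {k Γ ι : Type} [Zero k] {η : ι → Γ → k} {A : Set Γ}
    (hpt : ∀ γ, {i | η i γ ≠ 0}.Finite) (hA : ∀ i, (support (η i) ∩ A).Finite)
    (hinf : ((⋃ i, support (η i)) ∩ A).Infinite) :
    ∃ g : ℕ → Γ, (∀ n, g n ∈ (⋃ i, support (η i)) ∩ A) ∧
      ∀ m n, m ≠ n → ∀ i, η i (g m) ≠ 0 → η i (g n) = 0 := by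
  have : Std.Symm fun x y : Γ => ∀ i, η i x ≠ 0 → η i y = 0 :=
    ⟨fun x y h i hy => by_contra fun hx => hy (h i hx)⟩
  refine exists_seq_of_forall_finset_exists' (fun x => x ∈ (⋃ i, support (η i)) ∩ A)
    (fun x y => ∀ i, η i x ≠ 0 → η i y = 0) fun s _ => ?_
  have hbad : (⋃ x ∈ s, ⋃ i ∈ {i | η i x ≠ 0}, support (η i) ∩ A).Finite :=
    s.finite_toSet.biUnion fun x _ => (hpt x).biUnion fun i _ => hA i
  obtain ⟨y, hy, hys⟩ := hinf.exists_notMem_finite hbad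
  refine ⟨y, hy, fun x hx i hxi => by_contra fun hyi => hys ?_⟩
  simp only [Set.mem_iUnion]
  exact ⟨x, hx, i, hxi, hyi, hy.2⟩

theorem pairing_indicator_eq {k Γ : Type} [Field k] {S : Set Γ} {g : Γ → k} {γ : Γ} (hγ : γ ∈ S)
    (hg : ∀ δ ∈ S, δ ≠ γ → g δ = 0) : pairing (S.indicator fun _ => (1 : k)) g = g γ := by
  rw [pairing, finsum_eq_single _ γ, Set.indicator_of_mem hγ, one_mul]
  intro δ hδ
  by_cases h : δ ∈ S
  · rw [hg δ h hδ, mul_zero]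
  · rw [Set.indicator_of_notMem h, zero_mul]

theorem indicator_mem_bspace {k Γ : Type} [Field k] {F : Borno Γ} {S : Set Γ} (hS : S ∈ F.sets) :
    (S.indicator fun _ => (1 : k)) ∈ bspace k F :=
  F.subset_mem _ _ Set.support_indicator_subset hS

/-- if `(η_i)` is a family in `k(Γ;F^⊥)` such that for every `f ∈ k(Γ;F)` only
finitely many pairings `⟨f, η_i⟩` are nonzero, then `(η_i)` is summable in `k(Γ;F^⊥)`. -/
theorem stmt2 {k : Type} [Field k] {Γ ι : Type} (F : Borno Γ)
    (η : ι → Γ → k) (hη : ∀ i, η i ∈ bspace k F.orth)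
    (hfin : ∀ f ∈ bspace k F, {i | pairing f (η i) ≠ 0}.Finite) :
    SummableFam F.orth η := by
  have hpt : ∀ γ, {i | η i γ ≠ 0}.Finite := fun γ => by
    refine (hfin _ (indicator_mem_bspace (F.finite_mem _ (Set.finite_singleton γ)))).subset
      fun i hi => ?_
    rw [Set.mem_ofPred_eq, pairing_indicator_eq (Set.mem_singleton γ)
      fun δ hδ hne => absurd hδ hne]
    exact hi
  refine ⟨fun A hA => by_contra fun hinf => ?_, hpt⟩
  obtain ⟨g, hg, hsep⟩ := exists_seq_separated hpt (fun i => hη i A hA) hinf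
  choose i hi using fun n => Set.mem_iUnion.1 (hg n).1
  have hinj : Injective i := fun m n hmn => by_contra fun hne =>
    hi n (hsep m n hne (i n) (hmn ▸ hi m))
  have hrange : Set.range g ∈ F.sets :=
    F.subset_mem _ A (Set.range_subset_iff.2 fun n => (hg n).2) hA
  refine Set.infinite_range_of_injective hinj
    ((hfin _ (indicator_mem_bspace hrange)).subset ?_)
  rintro _ ⟨n, rfl⟩
  rw [Set.mem_ofPred_eq, pairing_indicator_eq (Set.mem_range_self n)]
  · exact hi n
  · rintro _ ⟨m, rfl⟩ hne
    exact hsep n m (fun h => hne (h ▸ rfl)) (i n) (hi n)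
end

section
/- Assume F = F^⊥⊥ (equivalently F = G^⊥ for some bornology G on Γ). Then a family (f_i)_{i∈I} in k(Γ;F) is summable if and only if for every g ∈ k(Γ;F^⊥) the set {i ∈ I : ⟨f_i,g⟩ ≠ 0} is finite. -/
open Function

theorem finite_setOf_pairing_ne_zero {k Γ ι : Type} [Field k] {f : ι → Γ → k} {g : Γ → k}
    (hcol : ∀ γ, {i | f i γ ≠ 0}.Finite)
    (hg : (support g ∩ ⋃ i, support (f i)).Finite) :
    {i | pairing (f i) g ≠ 0}.Finite := by
  refine (hg.biUnion fun γ _ => hcol γ).subset fun i hi => ?_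
  obtain ⟨γ, hγ⟩ : ∃ γ, f i γ * g γ ≠ 0 := by
    by_contra! h
    exact hi (finsum_eq_zero_of_forall_eq_zero h)
  have hf : f i γ ≠ 0 := left_ne_zero_of_mul hγ
  exact Set.mem_biUnion ⟨right_ne_zero_of_mul hγ, Set.mem_iUnion.2 ⟨i, hf⟩⟩ hf

theorem pairing_indicator_one {k Γ : Type} [Field k] {f : Γ → k} {s : Set Γ} {γ : Γ}
    (hγ : γ ∈ s) (h : ∀ δ ∈ s, δ ≠ γ → f δ = 0) :
    pairing f (s.indicator fun _ => 1) = f γ := by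
  rw [pairing, finsum_eq_single _ γ fun δ hδ => ?_]
  · simp [hγ]
  · by_cases hs : δ ∈ s <;> simp [hs, h, hδ]

/-- A row- and column-finite matrix with infinitely many nonzero columns contains an infinite
diagonal submatrix with nonzero diagonal entries. -/
theorem exists_seq_diagonal {k Γ ι : Type} [Field k] {f : ι → Γ → k} {S : Set Γ}
    (hrow : ∀ i, (S ∩ support (f i)).Finite) (hcol : ∀ γ, {i | f i γ ≠ 0}.Finite)
    (hS : (S ∩ ⋃ i, support (f i)).Infinite) :
    ∃ p : ℕ → ι × Γ, (∀ n, (p n).2 ∈ S ∧ f (p n).1 (p n).2 ≠ 0) ∧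
      ∀ m n, m ≠ n → f (p m).1 (p n).2 = 0 := by
  obtain ⟨p, hp, hr⟩ := exists_seq_of_forall_finset_exists
    (fun p : ι × Γ => p.2 ∈ S ∧ f p.1 p.2 ≠ 0)
    (fun p q => f p.1 q.2 = 0 ∧ f q.1 p.2 = 0) fun s _ => by
      have hR : (⋃ p ∈ s, {i | f i p.2 ≠ 0}).Finite :=
        s.finite_toSet.biUnion fun p _ => hcol p.2
      have hC : (⋃ p ∈ s, S ∩ support (f p.1)).Finite :=
        s.finite_toSet.biUnion fun p _ => hrow p.1
      obtain ⟨γ, ⟨hγS, hγ⟩, hγ'⟩ := (hS.sdiff (hC.union (hR.biUnion fun i _ => hrow i))).nonempty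
      obtain ⟨i, hi⟩ := Set.mem_iUnion.1 hγ
      refine ⟨(i, γ), ⟨hγS, hi⟩, fun q hq => ⟨?_, ?_⟩⟩
      · by_contra h
        exact hγ' (Or.inl (Set.mem_biUnion hq ⟨hγS, h⟩))
      · by_contra h
        exact hγ' (Or.inr (Set.mem_biUnion (Set.mem_biUnion hq h) ⟨hγS, hi⟩))
  refine ⟨p, hp, fun m n hmn => ?_⟩
  rcases hmn.lt_or_gt with h | h
  exacts [(hr m n h).1, (hr n m h).2]

/-- if `F = F^⊥⊥`, a family `(f_i)` in `k(Γ;F)` is summable iff for every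
`g ∈ k(Γ;F^⊥)` only finitely many of the pairings `⟨f_i, g⟩` are nonzero. -/
theorem stmt3 {k : Type} [Field k] {Γ ι : Type} (F : Borno Γ)
    (hF : F.orth.orth = F)
    (f : ι → Γ → k) (hmem : ∀ i, f i ∈ bspace k F) :
    SummableFam F f ↔
      ∀ g ∈ bspace k F.orth, {i | pairing (f i) g ≠ 0}.Finite := by
  constructor
  · rintro ⟨hU, hcol⟩ g hg
    exact finite_setOf_pairing_ne_zero hcol (hg _ hU)
  intro h
  have hcol (γ : Γ) : {i | f i γ ≠ 0}.Finite := by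
    have hpair (i : ι) : pairing (f i) (indic (k := k) F.orth γ) = f i γ :=
      pairing_indicator_one rfl fun δ hδ hne => absurd hδ hne
    simpa only [hpair] using h _ (indic F.orth γ).2
  refine ⟨?_, hcol⟩
  rw [← hF]
  intro S hS
  rw [Set.inter_comm]
  by_contra hinf
  obtain ⟨p, hp, hoff⟩ := exists_seq_diagonal (fun i => hS _ (hmem i)) hcol hinf
  have hpair (n : ℕ) : pairing (f (p n).1)
      ((Set.range fun m => (p m).2).indicator fun _ => 1) = f (p n).1 (p n).2 := by
    refine pairing_indicator_one ⟨n, rfl⟩ ?_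
    rintro _ ⟨m, rfl⟩ hne
    exact hoff n m fun hnm => hne (by rw [hnm])
  have hinj : Injective fun n => (p n).1 := fun m n hmn => by
    by_contra hne
    refine (hp n).2 ?_
    rw [← show (p m).1 = (p n).1 from hmn]
    exact hoff m n hne
  have hmem_orth : ((Set.range fun m => (p m).2).indicator fun _ => (1 : k)) ∈ bspace k F.orth :=
    F.orth.subset_mem _ S (Set.support_indicator_subset.trans
      (Set.range_subset_iff.2 fun n => (hp n).1)) hS
  refine Set.infinite_range_of_injective hinj ((h _ hmem_orth).subset ?_)
  rintro _ ⟨n, rfl⟩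
  exact (hpair n).trans_ne (hp n).2
end

section
/- Let Γ be a linearly ordered set and S ⊆ Γ. Then S ∩ F is finite for every reverse well-ordered subset F ⊆ Γ if and only if S is well-ordered. (Together with the previous computation this gives (WO_ω(Γ))^⊥⊥ = WO(Γ): the double orthogonal of the bornology generated by the subsets of order type ω is the collection of well-ordered subsets.) -/
/-- for a linearly ordered set `Γ` and `S ⊆ Γ`, the intersection `S ∩ F` is finite
for every reverse well-ordered subset `F ⊆ Γ` if and only if `S` is well-ordered
(`<` is well-founded on `S`). This gives `(WO_ω(Γ))^⊥⊥ = WO(Γ)`. -/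
theorem stmt5 {Γ : Type*} [LinearOrder Γ] (S : Set Γ) :
    (∀ F : Set Γ, F.WellFoundedOn (· > ·) → (S ∩ F).Finite) ↔
      S.WellFoundedOn (· < ·) := by
  constructor
  · intro h
    rw [Set.wellFoundedOn_iff_no_descending_seq]
    intro f hf
    have hF : (Set.range f).WellFoundedOn (· > ·) := by
      rw [Set.wellFoundedOn_range]
      exact Subrelation.wf (fun {a b} hab => f.map_rel_iff.mp hab) wellFounded_lt
    exact (Set.infinite_range_of_injective f.injective)
      ((h _ hF).subset fun x hx => ⟨by obtain ⟨n, rfl⟩ := hx; exact hf n, hx⟩)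
  · intro hS F hF
    have : WellFoundedLT ↥(S ∩ F) := ⟨hS.subset Set.inter_subset_left⟩
    have : WellFoundedGT ↥(S ∩ F) := ⟨hF.subset Set.inter_subset_right⟩
    exact Set.finite_coe_iff.mp (Finite.of_wellFoundedLT_wellFoundedGT _)
end

section
/- For all sets I and J, the assignment f ↦ f* is a bijection from the set of k-linear maps k^{⊕I} → k^{⊕J} onto the set of Σ-preserving k-linear maps k^J → k^I, where f*(g)(i) = Σ_j (f e_i)(j) · g(j) (a finite sum). (This is the full faithfulness underlying the equivalence between the category of the spaces k(I;P(I)) with Σ-preserving maps and the opposite of the category of k-vector spaces.) -/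
/-- In `k^I` (all functions `I → k`) a family is summable iff at every point only finitely
many members are nonzero; a linear map `T : k^J → k^I` is Σ-preserving if it sends such
families to such families and commutes with the (pointwise, finite) sums. -/
def SigmaPres {k I J : Type} [Field k] (T : (J → k) →ₗ[k] (I → k)) : Prop :=
  ∀ (ι : Type) (f : ι → J → k), (∀ j : J, {a | f a j ≠ 0}.Finite) →
    (∀ i : I, {a | T (f a) i ≠ 0}.Finite) ∧
    (∀ i : I, T (fun j => ∑ᶠ a, f a j) i = ∑ᶠ a, T (f a) i)

theorem finsum_finsupp_mul_eq {k J : Type} [Field k] (c : J →₀ k) (g : J → k) :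
    ∑ᶠ j, c j * g j = ∑ j ∈ c.support, c j * g j :=
  finsum_eq_finsetSum_of_support_subset _ fun j hj => by
    simpa using left_ne_zero_of_mul hj

/-- The transpose `f*` of a linear map between spaces of finitely supported functions. -/
noncomputable def finsuppTranspose {k I J : Type} [Field k] (f : (I →₀ k) →ₗ[k] (J →₀ k)) :
    (J → k) →ₗ[k] (I → k) where
  toFun g i := ∑ᶠ j, f (Finsupp.single i 1) j * g j
  map_add' g h := by
    ext i
    simp only [finsum_finsupp_mul_eq]
    simp [mul_add, Finset.sum_add_distrib]
  map_smul' r g := by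
    ext i
    simp only [finsum_finsupp_mul_eq]
    simp [Finset.mul_sum, mul_left_comm]

theorem sigmaPres_finsuppTranspose {k I J : Type} [Field k] (f : (I →₀ k) →ₗ[k] (J →₀ k)) :
    SigmaPres (finsuppTranspose f) := by
  intro ι u hu
  simp only [finsuppTranspose, LinearMap.coe_mk, AddHom.coe_mk, finsum_finsupp_mul_eq]
  refine ⟨fun i => ?_, fun i => ?_⟩
  · refine ((f (Finsupp.single i 1)).support.finite_toSet.biUnion fun j _ => hu j).subset
      fun a ha => ?_
    obtain ⟨j, hj, hne⟩ := Finset.exists_ne_zero_of_sum_ne_zero ha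
    exact Set.mem_biUnion hj (right_ne_zero_of_mul hne)
  · rw [finsum_sum_comm]
    · exact Finset.sum_congr rfl fun j _ => mul_finsum _ _
    · exact fun j _ => (hu j).subset fun a ha => right_ne_zero_of_mul ha

open Classical in
theorem setOf_piSingle_apply_ne_zero_finite {k J : Type} [Field k] (g : J → k) (j : J) :
    {a | (Pi.single a (g a) : J → k) j ≠ 0}.Finite :=
  (Set.finite_singleton j).subset fun a ha => by
    by_contra hne
    exact ha (Pi.single_eq_of_ne (fun h => hne h.symm) _)

open Classical in
theorem SigmaPres.apply_eq_finsum {k I J : Type} [Field k] {T : (J → k) →ₗ[k] (I → k)}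
    (hT : SigmaPres T) (g : J → k) (i : I) :
    T g i = ∑ᶠ j, T (Pi.single j 1) i * g j := by
  have h := (hT J (fun a => Pi.single a (g a)) (setOf_piSingle_apply_ne_zero_finite g)).2 i
  have hg : (fun j => ∑ᶠ a, (Pi.single a (g a) : J → k) j) = g := by
    ext j
    rw [finsum_eq_single _ j fun a ha => Pi.single_eq_of_ne ha.symm _, Pi.single_eq_same]
  rw [hg] at h
  rw [h]
  refine finsum_congr fun j => ?_
  have hs : (Pi.single j (g j) : J → k) = g j • Pi.single j 1 := by
    rw [← Pi.single_smul, smul_eq_mul, mul_one]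
  rw [hs, map_smul, Pi.smul_apply, smul_eq_mul, mul_comm]

/-- the assignment `f ↦ f*`, where `f*(g)(i) = Σ_j (f e_i)(j)·g(j)`, is a
bijection from linear maps `k^{⊕I} → k^{⊕J}` onto Σ-preserving linear maps `k^J → k^I`:
every `f` determines a unique Σ-preserving `T` satisfying the formula, and every
Σ-preserving `T` arises from a unique `f`. -/
theorem stmt9 (k I J : Type) [Field k] :
    (∀ f : (I →₀ k) →ₗ[k] (J →₀ k),
      ∃! T : (J → k) →ₗ[k] (I → k), SigmaPres T ∧
        ∀ (g : J → k) (i : I), T g i = ∑ᶠ j : J, f (Finsupp.single i 1) j * g j) ∧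
    (∀ T : (J → k) →ₗ[k] (I → k), SigmaPres T →
      ∃! f : (I →₀ k) →ₗ[k] (J →₀ k),
        ∀ (g : J → k) (i : I), T g i = ∑ᶠ j : J, f (Finsupp.single i 1) j * g j) := by
  classical
  refine ⟨fun f => ⟨finsuppTranspose f, ⟨sigmaPres_finsuppTranspose f, fun _ _ => rfl⟩, ?_⟩,
    fun T hT => ?_⟩
  · rintro T ⟨-, hT⟩
    exact LinearMap.ext fun g => funext fun i => hT g i
  · have hfin (i : I) : (Function.support fun j => T (Pi.single j 1) i).Finite :=
      (hT J (fun a => Pi.single a 1) (setOf_piSingle_apply_ne_zero_finite fun _ => 1)).1 i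
    refine ⟨Finsupp.linearCombination k fun i => Finsupp.ofSupportFinite _ (hfin i), ?_, ?_⟩
    · intro g i
      simp [hT.apply_eq_finsum g i, Finsupp.ofSupportFinite_coe]
    · intro f hf
      refine Finsupp.lhom_ext' fun i => LinearMap.ext_ring (Finsupp.ext fun j => ?_)
      have h := hf (Pi.single j 1) i
      rw [finsum_eq_single _ j fun a ha => by rw [Pi.single_eq_of_ne ha, mul_zero]] at h
      simpa [Finsupp.ofSupportFinite_coe] using h.symm
end

section
/- Let k carry the discrete topology and let V, W be k-vector spaces, with V* and W* carrying the weak topology (the topology induced from the product topology via V* ⊆ k^V, equivalently the topology of pointwise convergence). Then a k-linear map φ : V* → W* is continuous if and only if there exists a k-linear map f : W → V with φ = f* (i.e., φ(ξ) = ξ ∘ f for all ξ ∈ V*); moreover such f is unique. -/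
/-- The weak topology on the dual `V* = Module.Dual k V`: the topology induced from the
product topology on `k^V`, where `k` carries the discrete topology (`⊥`). This is the topology
of pointwise convergence on `V`. -/
def dualTop (k V : Type*) [Field k] [AddCommGroup V] [Module k V] :
    TopologicalSpace (Module.Dual k V) :=
  TopologicalSpace.induced (fun (ξ : Module.Dual k V) (v : V) => ξ v)
    (@Pi.topologicalSpace V (fun _ => k) (fun _ => ⊥))

theorem continuous_dualTop_iff {k W X : Type*} [Field k] [AddCommGroup W] [Module k W]
    [TopologicalSpace X] (g : X → Module.Dual k W) :
    @Continuous _ _ _ (dualTop k W) g ↔ ∀ w, @Continuous _ _ _ ⊥ fun x => g x w := by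
  let : TopologicalSpace k := ⊥
  exact continuous_induced_rng.trans continuous_pi_iff

theorem continuous_dualTop_eval {k V : Type*} [Field k] [AddCommGroup V] [Module k V] (v : V) :
    @Continuous _ _ (dualTop k V) ⊥ fun ξ : Module.Dual k V => ξ v := by
  let := dualTop k V
  exact (continuous_dualTop_iff (id : Module.Dual k V → Module.Dual k V)).1 continuous_id v

/-- A linear functional on `V*` that is continuous for the topology of pointwise convergence is
evaluation at a vector of `V`. -/
theorem mem_range_dual_eval_of_continuous {k V : Type*} [Field k] [AddCommGroup V] [Module k V]
    (L : Module.Dual k (Module.Dual k V)) (hL : @Continuous _ _ (dualTop k V) ⊥ L) :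
    L ∈ LinearMap.range (Module.Dual.eval k V) := by
  let : TopologicalSpace k := ⊥
  have : DiscreteTopology k := ⟨rfl⟩
  let := dualTop k V
  obtain ⟨t, ht, hts⟩ := isOpen_induced_iff.1 ((isOpen_discrete ({0} : Set k)).preimage hL)
  have h0 : (fun v => (0 : Module.Dual k V) v) ∈ t := by
    change (0 : Module.Dual k V) ∈ (fun (ξ : Module.Dual k V) (v : V) => ξ v) ⁻¹' t
    rw [hts]
    simp
  obtain ⟨I, u, hu, hut⟩ := isOpen_pi_iff.1 ht _ h0
  have hmem : L ∈ Submodule.span k (Set.range fun v : I => Module.Dual.eval k V v) := by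
    refine mem_span_of_iInf_ker_le_ker fun ξ hξ => ?_
    simp only [Submodule.mem_iInf, LinearMap.mem_ker, Module.Dual.eval_apply] at hξ
    have hξt : ξ ∈ (fun (ξ : Module.Dual k V) (v : V) => ξ v) ⁻¹' t := by
      refine hut fun v hv => ?_
      have := (hu v hv).2
      simpa [hξ ⟨v, hv⟩] using this
    rw [hts] at hξt
    exact hξt
  refine Submodule.span_le.2 ?_ hmem
  rintro _ ⟨v, rfl⟩
  exact ⟨v, rfl⟩

theorem LinearMap.dualMap_injective_of_field {k V W : Type*} [Field k] [AddCommGroup V]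
    [Module k V] [AddCommGroup W] [Module k W] :
    Function.Injective fun f : W →ₗ[k] V => f.dualMap := by
  intro f g h
  ext w
  refine Module.eval_apply_injective k (LinearMap.ext fun ξ => ?_)
  exact LinearMap.congr_fun (LinearMap.congr_fun h ξ) w

/-- with `k` discrete and duals carrying the topology of pointwise convergence,
a linear map `φ : V* → W*` is continuous iff it is the dual `f*` of a (unique) linear map
`f : W → V`. -/
theorem stmt12 {k V W : Type*} [Field k] [AddCommGroup V] [Module k V]
    [AddCommGroup W] [Module k W]
    (φ : Module.Dual k V →ₗ[k] Module.Dual k W) :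
    @Continuous _ _ (dualTop k V) (dualTop k W) φ ↔
      ∃! f : W →ₗ[k] V, φ = f.dualMap := by
  constructor
  · intro hφ
    have hrange (w : W) : φ.flip w ∈ LinearMap.range (Module.Dual.eval k V) := by
      let := dualTop k V
      exact mem_range_dual_eval_of_continuous _ ((continuous_dualTop_iff _).1 hφ w)
    let e := LinearEquiv.ofInjective (Module.Dual.eval k V) (Module.eval_apply_injective k)
    let f : W →ₗ[k] V := e.symm.toLinearMap ∘ₗ φ.flip.codRestrict _ hrange
    have hf : φ = f.dualMap := by
      ext ξ w
      have h : e (f w) = φ.flip.codRestrict _ hrange w := e.apply_symm_apply _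
      exact (LinearMap.congr_fun (congrArg Subtype.val h) ξ).symm
    exact ⟨f, hf, fun g hg => LinearMap.dualMap_injective_of_field (hg.symm.trans hf)⟩
  · rintro ⟨f, rfl, -⟩
    let := dualTop k V
    exact (continuous_dualTop_iff _).2 fun w => continuous_dualTop_eval (f w)
end

section
/- Let V be a k-vector space and let 𝒮 be a nonempty collection of subspaces of V that is closed under binary intersection and satisfies ⋂_{H∈𝒮} H = 0. Give the dual space V* the topology of pointwise convergence (k discrete). Then ⋃_{H∈𝒮} Ann(H) is dense in V*, where Ann(H) = {ξ ∈ V* : ξ vanishes on H} is the annihilator of H. -/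
theorem Submodule.exists_mem_disjoint_of_finiteDimensional {k V : Type*} [Field k]
    [AddCommGroup V] [Module k V] {𝒮 : Set (Submodule k V)} (hne : 𝒮.Nonempty)
    (hinter : ∀ H₁ ∈ 𝒮, ∀ H₂ ∈ 𝒮, H₁ ⊓ H₂ ∈ 𝒮)
    (htriv : ∀ v : V, (∀ H ∈ 𝒮, v ∈ H) → v = 0)
    (F : Submodule k V) [FiniteDimensional k F] : ∃ H ∈ 𝒮, Disjoint F H := by
  obtain ⟨_, ⟨H, hH, rfl⟩, hmin⟩ := IsArtinian.set_has_minimal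
    ((fun H : Submodule k V => H.comap F.subtype) '' 𝒮) (hne.image _)
  refine ⟨H, hH, Submodule.disjoint_def.2 fun v hvF hvH => htriv v fun K hK => ?_⟩
  by_contra hvK
  refine hmin _ ⟨H ⊓ K, hinter H hH K hK, rfl⟩ (lt_of_le_not_ge (fun x hx => hx.1) fun hle => ?_)
  exact hvK (hle (show (⟨v, hvF⟩ : F) ∈ H.comap F.subtype from hvH)).2

theorem Submodule.exists_mem_dualAnnihilator_eqOn {k V : Type*} [Field k]
    [AddCommGroup V] [Module k V] {F H : Submodule k V} (h : Disjoint F H)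
    (ξ : Module.Dual k V) : ∃ η ∈ H.dualAnnihilator, ∀ v ∈ F, η v = ξ v := by
  have hker : LinearMap.ker (H.mkQ ∘ₗ F.subtype) = ⊥ := by
    refine (Submodule.eq_bot_iff _).2 fun x hx => Subtype.ext ?_
    exact Submodule.disjoint_def.1 h x x.2 ((Submodule.Quotient.mk_eq_zero H).1 hx)
  obtain ⟨g, hg⟩ := LinearMap.exists_leftInverse_of_injective _ hker
  refine ⟨ξ ∘ₗ F.subtype ∘ₗ g ∘ₗ H.mkQ, ?_, fun v hv => ?_⟩
  · refine (Submodule.mem_dualAnnihilator _).2 fun w hw => ?_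
    simp [(Submodule.Quotient.mk_eq_zero H).2 hw]
  · have := LinearMap.congr_fun hg ⟨v, hv⟩
    exact congrArg (fun x : F => ξ x) this

/-- if `𝒮` is a nonempty collection of subspaces of `V`, closed under binary
intersection and with `⋂_{H∈𝒮} H = 0`, then `⋃_{H∈𝒮} Ann(H)` is dense in `V*` with the
topology of pointwise convergence (`k` discrete). -/
theorem stmt14 {k V : Type*} [Field k] [AddCommGroup V] [Module k V]
    (𝒮 : Set (Submodule k V)) (hne : 𝒮.Nonempty)
    (hinter : ∀ H₁ ∈ 𝒮, ∀ H₂ ∈ 𝒮, H₁ ⊓ H₂ ∈ 𝒮)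
    (htriv : ∀ v : V, (∀ H ∈ 𝒮, v ∈ H) → v = 0) :
    @Dense (Module.Dual k V) (dualTop k V)
      (⋃ H ∈ 𝒮, (Submodule.dualAnnihilator H : Set (Module.Dual k V))) := by
  let _ : TopologicalSpace k := ⊥
  let _ : TopologicalSpace (Module.Dual k V) := dualTop k V
  refine dense_iff_inter_open.2 ?_
  rintro _ ⟨U, hU, rfl⟩ ⟨ξ, hξ⟩
  obtain ⟨I, u, hu, hIU⟩ := isOpen_pi_iff.1 hU _ hξ
  obtain ⟨H, hH, hdisj⟩ := Submodule.exists_mem_disjoint_of_finiteDimensional hne hinter htriv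
    (Submodule.span k (I : Set V))
  obtain ⟨η, hη, heq⟩ := Submodule.exists_mem_dualAnnihilator_eqOn hdisj ξ
  refine ⟨η, hIU fun v hv => ?_, Set.mem_biUnion hH hη⟩
  simpa only [heq v (Submodule.subset_span hv)] using (hu v hv).2
end

section
/- Let V be a k-vector space, k discrete, and give the double dual V** the topology of pointwise convergence on V*. Then the canonical evaluation map ev : V → V**, ev(v)(ξ) = ξ(v), has dense range. Moreover, a subspace W ≤ V is open in the topology induced on V by ev if and only if W has finite codimension in V. -/
theorem isOpen_dualTop_iff {k V : Type*} [Field k] [AddCommGroup V] [Module k V]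
    {s : Set (Module.Dual k V)} :
    @IsOpen _ (dualTop k V) s ↔
      ∀ φ ∈ s, ∃ F : Finset V, ∀ ψ : Module.Dual k V, (∀ v ∈ F, ψ v = φ v) → ψ ∈ s := by
  let : TopologicalSpace k := ⊥
  have : DiscreteTopology k := ⟨rfl⟩
  refine isOpen_induced_iff.trans ?_
  constructor
  · rintro ⟨U, hU, rfl⟩ φ hφ
    obtain ⟨F, u, hu, hF⟩ := isOpen_pi_iff.mp hU _ hφ
    refine ⟨F, fun ψ hψ => hF fun v hv => ?_⟩
    change ψ v ∈ u v
    rw [hψ v hv]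
    exact (hu v hv).2
  · intro h
    choose! F hF using h
    refine ⟨⋃ φ ∈ s, (F φ : Set V).pi fun v => {φ v}, ?_, ?_⟩
    · exact isOpen_biUnion fun φ _ =>
        isOpen_set_pi (F φ).finite_toSet fun v _ => isOpen_discrete _
    · ext ψ
      simp only [Set.mem_preimage, Set.mem_iUnion, exists_prop]
      exact ⟨fun ⟨φ, hφ, h⟩ => hF φ hφ ψ h, fun hψ => ⟨ψ, hψ, fun _ _ => rfl⟩⟩

theorem exists_forall_mem_finset_apply_eq {k V : Type*} [Field k] [AddCommGroup V] [Module k V]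
    (F : Finset (Module.Dual k V)) (φ : Module.Dual k (Module.Dual k V)) :
    ∃ v : V, ∀ ξ ∈ F, ξ v = φ ξ := by
  classical
  let T : V →ₗ[k] F → k := LinearMap.pi fun ξ => ξ.1
  suffices h : (fun ξ : F => φ ξ) ∈ LinearMap.range T by
    obtain ⟨v, hv⟩ := h
    exact ⟨v, fun ξ hξ => congrFun hv ⟨ξ, hξ⟩⟩
  by_contra h
  obtain ⟨f, hf, hT⟩ := Submodule.exists_le_ker_of_notMem h
  have hsum : ∑ ξ : F, f (fun j => if ξ = j then 1 else 0) • ξ.1 = 0 := by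
    ext v
    have := hT (LinearMap.mem_range_self T v)
    rw [LinearMap.mem_ker, LinearMap.pi_apply_eq_sum_univ] at this
    simpa [T, mul_comm] using this
  apply hf
  rw [LinearMap.pi_apply_eq_sum_univ]
  have := congrArg φ hsum
  simpa [mul_comm] using this

/-- the evaluation map `ev : V → V**` has dense range when `V**` carries the
topology of pointwise convergence on `V*` (`k` discrete); and a subspace `W ≤ V` is open in
the topology induced on `V` by `ev` iff `W` has finite codimension (`V/W` is
finite-dimensional). -/
theorem stmt15 (k V : Type*) [Field k] [AddCommGroup V] [Module k V] :
    @Dense _ (dualTop k (Module.Dual k V)) (Set.range (Module.Dual.eval k V)) ∧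
    (∀ W : Submodule k V,
      @IsOpen V
        (TopologicalSpace.induced (Module.Dual.eval k V) (dualTop k (Module.Dual k V)))
        (W : Set V)
      ↔ Module.Finite k (V ⧸ W)) := by
  constructor
  · let := dualTop k (Module.Dual k V)
    rw [dense_iff_inter_open]
    rintro U hU ⟨φ, hφ⟩
    obtain ⟨F, hF⟩ := isOpen_dualTop_iff.mp hU φ hφ
    obtain ⟨v, hv⟩ := exists_forall_mem_finset_apply_eq F φ
    exact ⟨Module.Dual.eval k V v, hF _ hv, v, rfl⟩
  · intro W
    let := dualTop k (Module.Dual k V)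
    refine isOpen_induced_iff.trans ?_
    constructor
    · rintro ⟨U, hU, hUW⟩
      have h0 : Module.Dual.eval k V 0 ∈ U := by
        rw [← Set.mem_preimage, hUW]
        exact W.zero_mem
      obtain ⟨F, hF⟩ := isOpen_dualTop_iff.mp hU _ h0
      let T : V →ₗ[k] F → k := LinearMap.pi fun ξ => ξ.1
      have hT : LinearMap.ker T ≤ W := fun v hv => by
        rw [← SetLike.mem_coe, ← hUW]
        refine hF _ fun ξ hξ => ?_
        simpa [T] using congrFun (LinearMap.mem_ker.mp hv) ⟨ξ, hξ⟩
      have : Module.Finite k (V ⧸ LinearMap.ker T) :=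
        Module.Finite.equiv T.quotKerEquivRange.symm
      exact Module.Finite.of_surjective _ (Submodule.factor_surjective hT)
    · intro _
      classical
      let b := Module.finBasis k (V ⧸ W)
      refine ⟨{ψ : Module.Dual k (Module.Dual k V) | ∀ i, ψ (b.coord i ∘ₗ W.mkQ) = 0}, isOpen_dualTop_iff.mpr fun φ hφ =>
        ⟨Finset.univ.image fun i => b.coord i ∘ₗ W.mkQ, fun ψ hψ i => ?_⟩, ?_⟩
      · rw [hψ _ (Finset.mem_image_of_mem _ (Finset.mem_univ i)), hφ i]
      · ext v
        exact b.forall_coord_eq_zero_iff.trans (Submodule.Quotient.mk_eq_zero W)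
end

section
/- Let I be a set and k(Γ;F) a based strong vector space. The map sending a Σ-preserving k-linear map T : k^I → k(Γ;F) to the family (T δ_i)_{i∈I} is a bijection onto the set of summable I-indexed families in k(Γ;F); its inverse sends a summable family (f_i)_{i∈I} to the map (c_i)_{i∈I} ↦ Σ_{i∈I} c_i · f_i (the scaled family (c_i·f_i)_{i∈I} being summable for every (c_i)_{i∈I} ∈ k^I). -/
open Function

/-- The full bornology (all subsets) on a set, giving `k(I;P(I)) = k^I`. -/
def Borno.full (I : Type) : Borno I where
  sets := Set.univ
  finite_mem := fun _ _ => Set.mem_univ _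
  subset_mem := fun _ _ _ _ => Set.mem_univ _
  union_mem := fun _ _ _ _ => Set.mem_univ _

theorem summableFam_indic_s18 {k : Type} [Field k] {I : Type} :
    SummableFam (Borno.full I) (fun i => (indic (k := k) (Borno.full I) i : I → k)) := by
  refine ⟨Set.mem_univ _, fun j => (Set.finite_singleton j).subset fun i hi => ?_⟩
  by_contra hij
  have hji : j ∉ ({i} : Set I) := fun h => hij h.symm
  exact hi (Set.indicator_of_notMem hji fun _ => (1 : k))

theorem summableFam_smul_indic_s18 {k : Type} [Field k] {I : Type} (c : I → k) :
    SummableFam (Borno.full I)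
      (fun i => ((c i • indic (Borno.full I) i : bspace k (Borno.full I)) : I → k)) := by
  refine ⟨Set.mem_univ _, fun j => ((summableFam_indic_s18 (k := k)).2 j).subset fun i hi h => hi ?_⟩
  simp [h]

theorem sumElem_smul_indic_s18 {k : Type} [Field k] {I : Type} (c : bspace k (Borno.full I)) :
    sumElem (Borno.full I) (fun i => (c : I → k) i • indic (Borno.full I) i)
      (summableFam_smul_indic_s18 (c : I → k)) = c := by
  ext j
  change ∑ᶠ i, (c : I → k) i * Set.indicator {i} (fun _ => (1 : k)) j = (c : I → k) j
  rw [finsum_eq_single _ j fun i hi => by simp [hi.symm]]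
  simp

theorem SummableFam.smul {k : Type} [Field k] {Γ I : Type} {F : Borno Γ} {f : I → Γ → k}
    (hf : SummableFam F f) (c : I → k) : SummableFam F (fun i => c i • f i) := by
  refine ⟨F.subset_mem _ _ (Set.iUnion_mono fun i => ?_) hf.1, fun γ => ?_⟩
  · exact Function.support_const_smul_subset (c i) (f i)
  · refine (hf.2 γ).subset fun i hi h => hi ?_
    simp [h]

theorem SummableFam.finite_support_mul {k : Type} [Field k] {Γ I : Type} {F : Borno Γ}
    {f : I → Γ → k} (hf : SummableFam F f) (c : I → k) (γ : Γ) :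
    (Function.support fun i => c i * f i γ).Finite :=
  (hf.smul c).2 γ

/-- The linear map `(c_i) ↦ Σ_i c_i • f_i` attached to a summable family `f`. -/
noncomputable def SummableFam.comb {k : Type} [Field k] {Γ I : Type} {F : Borno Γ}
    {f : I → Γ → k} (hf : SummableFam F f) : bspace k (Borno.full I) →ₗ[k] bspace k F where
  toFun c := ⟨famSum fun i => (c : I → k) i • f i, famSum_mem F _ (hf.smul (c : I → k))⟩
  map_add' c d := by
    ext γ
    change ∑ᶠ i, ((c : I → k) i + (d : I → k) i) * f i γ =
      ∑ᶠ i, (c : I → k) i * f i γ + ∑ᶠ i, (d : I → k) i * f i γ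
    simp only [add_mul]
    exact finsum_add_distrib (hf.finite_support_mul _ γ) (hf.finite_support_mul _ γ)
  map_smul' a c := by
    ext γ
    change ∑ᶠ i, (a * (c : I → k) i) * f i γ = a * ∑ᶠ i, (c : I → k) i * f i γ
    simp only [mul_assoc]
    exact (mul_finsum _ a).symm

theorem SummableFam.comb_apply {k : Type} [Field k] {Γ I : Type} {F : Borno Γ}
    {f : I → Γ → k} (hf : SummableFam F f) (c : bspace k (Borno.full I)) (γ : Γ) :
    (hf.comb c : Γ → k) γ = ∑ᶠ i, (c : I → k) i * f i γ :=
  rfl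

theorem SummableFam.comb_apply_eq_sum {k : Type} [Field k] {Γ I : Type} {F : Borno Γ}
    {f : I → Γ → k} (hf : SummableFam F f) (c : bspace k (Borno.full I)) (γ : Γ) :
    (hf.comb c : Γ → k) γ = ∑ i ∈ (hf.2 γ).toFinset, (c : I → k) i * f i γ := by
  rw [hf.comb_apply]
  refine finsum_eq_sum_of_support_subset _ fun i hi => ?_
  simpa using right_ne_zero_of_mul hi

theorem SummableFam.comb_indic {k : Type} [Field k] {Γ I : Type} {F : Borno Γ}
    {f : I → Γ → k} (hf : SummableFam F f) (i : I) :
    (hf.comb (indic (Borno.full I) i) : Γ → k) = f i := by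
  ext γ
  change ∑ᶠ j, Set.indicator {i} (fun _ => (1 : k)) j * f j γ = f i γ
  rw [finsum_eq_single _ i fun j hj => by simp [hj]]
  simp

theorem SummableFam.exists_of_comb_ne_zero {k : Type} [Field k] {Γ I : Type} {F : Borno Γ}
    {f : I → Γ → k} (hf : SummableFam F f) {c : bspace k (Borno.full I)} {γ : Γ}
    (h : (hf.comb c : Γ → k) γ ≠ 0) : ∃ i, (c : I → k) i ≠ 0 ∧ f i γ ≠ 0 := by
  rw [hf.comb_apply_eq_sum] at h
  obtain ⟨i, _, hi⟩ := Finset.exists_ne_zero_of_sum_ne_zero h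
  exact ⟨i, left_ne_zero_of_mul hi, right_ne_zero_of_mul hi⟩

theorem SummableFam.summableFam_comb {k : Type} [Field k] {Γ I : Type} {F : Borno Γ}
    {f : I → Γ → k} (hf : SummableFam F f) {ι : Type} {g : ι → bspace k (Borno.full I)}
    (hg : SummableFam (Borno.full I) (fun j => (g j : I → k))) :
    SummableFam F (fun j => (hf.comb (g j) : Γ → k)) := by
  refine ⟨F.subset_mem _ _ (Set.iUnion_subset fun j γ hγ => ?_) hf.1, fun γ => ?_⟩
  · obtain ⟨i, _, hi⟩ := hf.exists_of_comb_ne_zero hγ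
    exact Set.mem_iUnion.2 ⟨i, hi⟩
  · refine ((hf.2 γ).biUnion fun i _ => hg.2 i).subset fun j hj => ?_
    obtain ⟨i, hc, hi⟩ := hf.exists_of_comb_ne_zero hj
    exact Set.mem_biUnion hi hc

theorem SummableFam.sigmaPreserving_comb {k : Type} [Field k] {Γ I : Type} {F : Borno Γ}
    {f : I → Γ → k} (hf : SummableFam F f) : SigmaPreserving hf.comb := by
  intro ι g hg
  refine ⟨hf.summableFam_comb hg, ?_⟩
  ext γ
  rw [hf.comb_apply_eq_sum]
  change ∑ i ∈ (hf.2 γ).toFinset, (∑ᶠ j, (g j : I → k) i) * f i γ =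
    ∑ᶠ j, (hf.comb (g j) : Γ → k) γ
  simp only [hf.comb_apply_eq_sum]
  rw [finsum_sum_comm]
  · exact Finset.sum_congr rfl fun i _ => finsum_mul _ _
  · exact fun i _ => (hg.2 i).subset fun j hj => left_ne_zero_of_mul hj

theorem SigmaPreserving.eq_of_indic {k : Type} [Field k] {Γ I : Type} {F : Borno Γ}
    {T T' : bspace k (Borno.full I) →ₗ[k] bspace k F} (hT : SigmaPreserving T)
    (hT' : SigmaPreserving T')
    (h : ∀ i : I, T (indic (Borno.full I) i) = T' (indic (Borno.full I) i)) : T = T' := by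
  ext1 c
  obtain ⟨_, e⟩ := hT I _ (summableFam_smul_indic_s18 (c : I → k))
  obtain ⟨_, e'⟩ := hT' I _ (summableFam_smul_indic_s18 (c : I → k))
  rw [sumElem_smul_indic_s18] at e e'
  rw [e, e']
  simp only [map_smul, h]

/-- the map `T ↦ (T δ_i)_{i∈I}` is a bijection from Σ-preserving linear maps
`k^I → k(Γ;F)` onto summable `I`-indexed families in `k(Γ;F)`; its inverse sends a summable
family `(f_i)` to `(c_i) ↦ Σ_i c_i·f_i`, the scaled family `(c_i·f_i)` being summable for
every `(c_i) ∈ k^I`. -/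
theorem stmt18 {k : Type} [Field k] {Γ I : Type} (F : Borno Γ) :
    -- the assignment lands in summable families
    (∀ T : bspace k (Borno.full I) →ₗ[k] bspace k F, SigmaPreserving T →
      SummableFam F (fun i => (T (indic (Borno.full I) i) : Γ → k))) ∧
    -- injectivity
    (∀ T T' : bspace k (Borno.full I) →ₗ[k] bspace k F,
      SigmaPreserving T → SigmaPreserving T' →
      (∀ i : I, T (indic (Borno.full I) i) = T' (indic (Borno.full I) i)) → T = T') ∧
    -- surjectivity, with the formula for the inverse and summability of scaled families
    (∀ f : I → bspace k F, SummableFam F (fun i => (f i : Γ → k)) →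
      (∀ c : I → k, SummableFam F (fun i => c i • (f i : Γ → k))) ∧
      ∃ T : bspace k (Borno.full I) →ₗ[k] bspace k F,
        SigmaPreserving T ∧
        (∀ i : I, T (indic (Borno.full I) i) = f i) ∧
        (∀ (c : bspace k (Borno.full I)) (γ : Γ),
          (T c : Γ → k) γ = ∑ᶠ i : I, (c : I → k) i * (f i : Γ → k) γ)) := by
  refine ⟨fun T hT => (hT I _ summableFam_indic_s18).1, fun T T' hT hT' h => hT.eq_of_indic hT' h,
    fun f hf => ⟨hf.smul, hf.comb, hf.sigmaPreserving_comb, fun i => ?_, hf.comb_apply⟩⟩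
  exact Subtype.ext (hf.comb_indic i)
end

section
/- Let R be a ring and consider a commutative diagram of R-modules with exact rows: a top row a0 →f0 b0 →g0 c0 →h0 d0 → 0 (exact at b0 and c0, with h0 surjective), a bottom row 0 → a1 →f1 b1 →g1 c1 →h1 d1 (f1 injective, exact at b1 and c1), and vertical maps α : a0 → a1, β : b0 → b1, γ : c0 → c1, δ : d0 → d1 making all squares commute. Then the square γ ∘ g0 = g1 ∘ β is a weak pullback — meaning for every x ∈ b1 and y ∈ c0 with g1(x) = γ(y) there exists z ∈ b0 with β(z) = x and g0(z) = y — if and only if α is surjective and δ is injective. -/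
/-- given a commutative diagram of `R`-modules with exact rows
`a0 → b0 → c0 → d0 → 0` and `0 → a1 → b1 → c1 → d1` and vertical maps `α, β, γ, δ`,
the square `γ ∘ g0 = g1 ∘ β` is a weak pullback iff `α` is surjective and `δ` is
injective. -/
theorem stmt19 {R : Type*} [Ring R]
    {a0 b0 c0 d0 a1 b1 c1 d1 : Type*}
    [AddCommGroup a0] [Module R a0] [AddCommGroup b0] [Module R b0]
    [AddCommGroup c0] [Module R c0] [AddCommGroup d0] [Module R d0]
    [AddCommGroup a1] [Module R a1] [AddCommGroup b1] [Module R b1]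
    [AddCommGroup c1] [Module R c1] [AddCommGroup d1] [Module R d1]
    (f0 : a0 →ₗ[R] b0) (g0 : b0 →ₗ[R] c0) (h0 : c0 →ₗ[R] d0)
    (f1 : a1 →ₗ[R] b1) (g1 : b1 →ₗ[R] c1) (h1 : c1 →ₗ[R] d1)
    (α : a0 →ₗ[R] a1) (β : b0 →ₗ[R] b1) (γ : c0 →ₗ[R] c1) (δ : d0 →ₗ[R] d1)
    (hb0 : Function.Exact f0 g0) (hc0 : Function.Exact g0 h0)
    (hh0 : Function.Surjective h0)
    (hf1 : Function.Injective f1)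
    (hb1 : Function.Exact f1 g1) (hc1 : Function.Exact g1 h1)
    (sq1 : f1 ∘ₗ α = β ∘ₗ f0) (sq2 : g1 ∘ₗ β = γ ∘ₗ g0) (sq3 : h1 ∘ₗ γ = δ ∘ₗ h0) :
    (∀ (x : b1) (y : c0), g1 x = γ y → ∃ z : b0, β z = x ∧ g0 z = y) ↔
      (Function.Surjective α ∧ Function.Injective δ) := by
  have comm1 (w : a0) : f1 (α w) = β (f0 w) := LinearMap.congr_fun sq1 w
  have comm2 (z : b0) : g1 (β z) = γ (g0 z) := LinearMap.congr_fun sq2 z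
  have comm3 (y : c0) : h1 (γ y) = δ (h0 y) := LinearMap.congr_fun sq3 y
  constructor
  · intro hwp
    refine ⟨fun a => ?_, (injective_iff_map_eq_zero δ).2 fun d hd => ?_⟩
    · obtain ⟨z, hz, hz0⟩ := hwp (f1 a) 0 (by rw [hb1.apply_apply_eq_zero, map_zero])
      obtain ⟨w, rfl⟩ := (hb0 z).1 hz0
      exact ⟨w, hf1 ((comm1 w).trans hz)⟩
    · obtain ⟨y, rfl⟩ := hh0 d
      obtain ⟨x, hx⟩ := (hc1 (γ y)).1 ((comm3 y).trans hd)
      obtain ⟨z, -, rfl⟩ := hwp x y hx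
      exact hc0.apply_apply_eq_zero z
  · rintro ⟨hα, hδ⟩ x y hxy
    have hy : h0 y = 0 := hδ (by rw [← comm3, ← hxy, hc1.apply_apply_eq_zero, map_zero])
    obtain ⟨z, rfl⟩ := (hc0 y).1 hy
    obtain ⟨a, ha⟩ := (hb1 (x - β z)).1 (by rw [map_sub, hxy, comm2, sub_self])
    obtain ⟨w, rfl⟩ := hα a
    refine ⟨z + f0 w, ?_, ?_⟩
    · rw [map_add, ← comm1, ha, add_sub_cancel]
    · rw [map_add, hb0.apply_apply_eq_zero, add_zero]
end
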